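/- Let G be a finite complete bipartite graph with color map c whose two color classes have m and n vertices respectively, with m ≥ 2 and n ≥ 2. If G admits a WG-drawing f with witness set P such that the image of f and P are linearly separable, then m ≤ 2 and n ≤ 2. Equivalently, a complete bipartite graph admitting a linearly separable WG-drawing does not contain K_{2,3} as a subgraph. -/

import Mathlib

noncomputable section

/-- The Euclidean plane. -/
abbrev Pt : Type := EuclideanSpace ℝ (Fin 2)

/-- The Gabriel disk `D[u,v]`: the closed disk having `u` and `v` as antipodal points. -/
def gabrielDisk (u v : Pt) : Set Pt := Metric.closedBall (midpoint ℝ u v) (dist u v / 2)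

/-- `f` is a witness Gabriel drawing of the finite simple graph `G` with witness set `P`. -/
def IsWGDrawing {V : Type*} [Fintype V] (G : SimpleGraph V) (f : V → Pt) (P : Set Pt) : Prop :=
  Function.Injective f ∧ Disjoint (Set.range f) P ∧
    ∀ u v : V, u ≠ v → (G.Adj u v ↔ gabrielDisk (f u) (f v) ∩ P = ∅)

/-- `⟨f₀, f₁⟩` is a mutual witness Gabriel drawing of the pair `⟨G₀, G₁⟩`. -/
def IsMWGDrawing {V₀ V₁ : Type*} [Fintype V₀] [Fintype V₁]
    (G₀ : SimpleGraph V₀) (G₁ : SimpleGraph V₁) (f₀ : V₀ → Pt) (f₁ : V₁ → Pt) : Prop :=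
  Function.Injective f₀ ∧ Function.Injective f₁ ∧
    Disjoint (Set.range f₀) (Set.range f₁) ∧
    (∀ u v : V₀, u ≠ v → (G₀.Adj u v ↔ gabrielDisk (f₀ u) (f₀ v) ∩ Set.range f₁ = ∅)) ∧
    (∀ u v : V₁, u ≠ v → (G₁.Adj u v ↔ gabrielDisk (f₁ u) (f₁ v) ∩ Set.range f₀ = ∅))

/-- Two subsets of the plane are linearly separable. -/
def LinSep (A B : Set Pt) : Prop :=
  ∃ (φ : Pt →ₗ[ℝ] ℝ) (c : ℝ), φ ≠ 0 ∧ (∀ a ∈ A, φ a < c) ∧ ∀ b ∈ B, c < φ b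

/-- The slope at which `w` sees a point `v` of smaller ordinate, measured from the downward
vertical direction. -/
def viewSlope (w v : ℝ × ℝ) : ℝ := (v.1 - w.1) / (w.2 - v.2)

lemma viewSlope_mediant {u v w : ℝ × ℝ} (huv : v.2 < u.2) (hwu : u.2 < w.2) :
    (w.2 - v.2) * viewSlope w v =
      (w.2 - u.2) * viewSlope w u + (u.2 - v.2) * viewSlope u v := by
  have h₁ : w.2 - v.2 ≠ 0 := by linarith
  have h₂ : w.2 - u.2 ≠ 0 := by linarith
  have h₃ : u.2 - v.2 ≠ 0 := by linarith
  unfold viewSlope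
  rw [mul_div_cancel₀ _ h₁, mul_div_cancel₀ _ h₂, mul_div_cancel₀ _ h₃]
  ring

lemma viewSlope_lt_of_lt {u v w : ℝ × ℝ} (huv : v.2 < u.2) (hwu : u.2 < w.2)
    (h : viewSlope w v < viewSlope w u) : viewSlope u v < viewSlope w v := by
  have := viewSlope_mediant huv hwu
  nlinarith [mul_lt_mul_of_pos_left h (sub_pos.2 hwu)]

lemma lt_viewSlope_of_lt {u v w : ℝ × ℝ} (huv : v.2 < u.2) (hwu : u.2 < w.2)
    (h : viewSlope w u < viewSlope w v) : viewSlope w v < viewSlope u v := by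
  have := viewSlope_mediant huv hwu
  nlinarith [mul_lt_mul_of_pos_left h (sub_pos.2 hwu)]

lemma viewSlope_lt_of_snd_eq {u v w w' : ℝ × ℝ} (huv : u.2 = v.2) (hw : u.2 < w.2)
    (hw' : u.2 < w'.2) (h : viewSlope w u < viewSlope w v) :
    viewSlope w' u < viewSlope w' v := by
  unfold viewSlope at *
  rw [← huv] at h ⊢
  rw [div_lt_div_iff_of_pos_right (by linarith)] at h ⊢
  linarith

/-- If two points see `u` and the lower point `v` in opposite orders, then the order of their
view slopes to `v` is determined. -/
lemma viewSlope_lt_viewSlope {u v w w' : ℝ × ℝ} (huv : v.2 < u.2) (hw : u.2 < w.2)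
    (hw' : u.2 < w'.2) (h : viewSlope w u < viewSlope w v)
    (h' : viewSlope w' v < viewSlope w' u) : viewSlope w v < viewSlope w' v :=
  (lt_viewSlope_of_lt huv hw h).trans (viewSlope_lt_of_lt huv hw' h')

/-- The points `v` and `v'` are seen from `w` strictly between `u` and `u'`. -/
structure SeesBetween (w u v v' u' : ℝ × ℝ) : Prop where
  left : viewSlope w u < viewSlope w v
  left' : viewSlope w u < viewSlope w v'
  right : viewSlope w v < viewSlope w u'
  right' : viewSlope w v' < viewSlope w u'
  obtuse : viewSlope w u * viewSlope w u' ≤ -1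
  acute : -1 < viewSlope w v * viewSlope w v'

lemma exists_between_of_mul_le_neg_one {s s' t : ℝ} (hlt : s < s') (h : s * s' ≤ -1)
    (ht : -1 < s * t) (ht' : -1 < s' * t) : s < t ∧ t < s' := by
  have hs : s < 0 := by nlinarith [sq_nonneg s]
  have hs' : 0 < s' := by nlinarith [sq_nonneg s']
  constructor <;> by_contra! hle
  · nlinarith
  · nlinarith

lemma neg_one_lt_mul_of_between {s s' t t' : ℝ} (hs : s < t) (hs' : t < s')
    (h : -1 < s * t') (h' : -1 < s' * t') : -1 < t * t' := by
  rcases le_total 0 t' with h0 | h0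
  · nlinarith
  · nlinarith

lemma seesBetween_of_obtuse {w u v v' u' : ℝ × ℝ} (hlt : viewSlope w u < viewSlope w u')
    (h : viewSlope w u * viewSlope w u' ≤ -1)
    (h₁ : -1 < viewSlope w u * viewSlope w v) (h₂ : -1 < viewSlope w u' * viewSlope w v)
    (h₃ : -1 < viewSlope w u * viewSlope w v') (h₄ : -1 < viewSlope w u' * viewSlope w v') :
    SeesBetween w u v v' u' := by
  obtain ⟨a, b⟩ := exists_between_of_mul_le_neg_one hlt h h₁ h₂
  obtain ⟨a', b'⟩ := exists_between_of_mul_le_neg_one hlt h h₃ h₄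
  exact ⟨a, a', b, b', h, neg_one_lt_mul_of_between a b h₃ h₄⟩

lemma SeesBetween.false_of_below {p q a₁ a₂ b₁ b₂ : ℝ × ℝ} (hp : SeesBetween p b₁ a₁ a₂ b₂)
    (hq : SeesBetween q a₁ b₁ b₂ a₂) (hp₁ : a₁.2 < p.2) (hp₂ : a₂.2 < p.2)
    (hq₁ : a₁.2 < q.2) (hq₂ : a₂.2 < q.2) (h₁ : b₁.2 < a₁.2) (h₂ : b₂.2 < a₂.2) : False := by
  have hl := viewSlope_lt_viewSlope h₁ hq₁ hp₁ hq.left hp.left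
  have hr := viewSlope_lt_viewSlope h₂ hp₂ hq₂ hp.right' hq.right'
  have hlt := hp.left.trans hp.right
  have hobt := hp.obtuse
  have hac := hq.acute
  have hneg : viewSlope p b₁ < 0 := by nlinarith [sq_nonneg (viewSlope p b₁)]
  have hpos : 0 < viewSlope p b₂ := by nlinarith [sq_nonneg (viewSlope p b₂)]
  nlinarith

/-- Witnesses `p` and `q` of the two non-adjacent pairs of an alternating 4-cycle force
a zigzag in the heights of its vertices. -/
lemma SeesBetween.zigzag {p q a₁ a₂ b₁ b₂ : ℝ × ℝ} {c : ℝ} (hp : SeesBetween p b₁ a₁ a₂ b₂)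
    (hq : SeesBetween q a₁ b₁ b₂ a₂) (hpc : c < p.2) (hqc : c < q.2) (ha₁ : a₁.2 < c)
    (ha₂ : a₂.2 < c) (hb₁ : b₁.2 < c) (hb₂ : b₂.2 < c) :
    (b₁.2 < a₁.2 ∧ a₂.2 < b₂.2) ∨ (a₁.2 < b₁.2 ∧ b₂.2 < a₂.2) := by
  rcases lt_trichotomy b₁.2 a₁.2 with h₁ | h₁ | h₁
  · rcases lt_trichotomy b₂.2 a₂.2 with h₂ | h₂ | h₂
    · exact (hp.false_of_below hq (by linarith) (by linarith) (by linarith) (by linarith)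
        h₁ h₂).elim
    · exact (lt_asymm hp.right'
        (viewSlope_lt_of_snd_eq h₂ (by linarith) (by linarith) hq.right')).elim
    · exact Or.inl ⟨h₁, h₂⟩
  · exact (lt_asymm hq.left
      (viewSlope_lt_of_snd_eq h₁ (by linarith) (by linarith) hp.left)).elim
  · rcases lt_trichotomy b₂.2 a₂.2 with h₂ | h₂ | h₂
    · exact Or.inr ⟨h₁, h₂⟩
    · exact (lt_asymm hp.right'
        (viewSlope_lt_of_snd_eq h₂ (by linarith) (by linarith) hq.right')).elim
    · exact (hq.false_of_below hp (by linarith) (by linarith) (by linarith) (by linarith)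
        h₁ h₂).elim

/-- If `b` lies strictly between `a` and `a'` in height, then no two points see `b` to the right
and to the left of both of them, respectively. -/
lemma viewSlope_false_of_straddle {p p' a a' b : ℝ × ℝ} (hab : b.2 < a.2) (hba : a'.2 < b.2)
    (hp : a.2 < p.2) (hp' : a.2 < p'.2) (h₁ : viewSlope p a < viewSlope p b)
    (h₂ : viewSlope p a' < viewSlope p b) (h₃ : viewSlope p' b < viewSlope p' a)
    (h₄ : viewSlope p' b < viewSlope p' a') : False := by
  have e₁ := lt_viewSlope_of_lt hab hp h₁
  have e₂ := viewSlope_lt_of_lt hba (hab.trans hp) h₂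
  have e₃ := viewSlope_lt_of_lt hab hp' h₃
  have e₄ := lt_viewSlope_of_lt hba (hab.trans hp') h₄
  linarith

/-- There is no drawing of `K_{2,3}` with vertices below and witnesses above a horizontal line:
the classes `{a₁, a₂}` and `{b 0, b 1, b 2}` cannot be realised. -/
lemma false_of_two_three {P : Set (ℝ × ℝ)} {c : ℝ} {a₁ a₂ : ℝ × ℝ} {b : Fin 3 → ℝ × ℝ}
    (hP : ∀ w ∈ P, c < w.2) (ha₁ : a₁.2 < c) (ha₂ : a₂.2 < c) (hb : ∀ i, (b i).2 < c)
    (hedge₁ : ∀ i, ∀ w ∈ P, -1 < viewSlope w a₁ * viewSlope w (b i))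
    (hedge₂ : ∀ i, ∀ w ∈ P, -1 < viewSlope w a₂ * viewSlope w (b i))
    (haa : ∃ w ∈ P, viewSlope w a₁ * viewSlope w a₂ ≤ -1)
    (hbb : ∀ i j, i ≠ j → ∃ w ∈ P, viewSlope w (b i) * viewSlope w (b j) ≤ -1) : False := by
  obtain ⟨q, hqP, hq⟩ := haa
  wlog hlt : viewSlope q a₁ < viewSlope q a₂ generalizing a₁ a₂
  · refine this ha₂ ha₁ hedge₂ hedge₁ (by linarith) (lt_of_le_of_ne (not_lt.1 hlt) fun h => ?_)
    rw [h] at hq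
    nlinarith [sq_nonneg (viewSlope q a₁)]
  have hqb (i j) : SeesBetween q a₁ (b i) (b j) a₂ :=
    seesBetween_of_obtuse hlt hq (hedge₁ i q hqP) (hedge₂ i q hqP) (hedge₁ j q hqP)
      (hedge₂ j q hqP)
  let R (i j : Fin 3) : Prop := ∃ p ∈ P, SeesBetween p (b i) a₁ a₂ (b j)
  have hbetween {i j p} (hp : p ∈ P) (h : viewSlope p (b i) * viewSlope p (b j) ≤ -1)
      (hl : viewSlope p (b i) < viewSlope p (b j)) : R i j := by
    refine ⟨p, hp, seesBetween_of_obtuse hl h ?_ ?_ ?_ ?_⟩ <;> rw [mul_comm]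
    exacts [hedge₁ i p hp, hedge₁ j p hp, hedge₂ i p hp, hedge₂ j p hp]
  have hR (i j : Fin 3) (hij : i ≠ j) : R i j ∨ R j i := by
    obtain ⟨p, hpP, hp⟩ := hbb i j hij
    rcases lt_trichotomy (viewSlope p (b i)) (viewSlope p (b j)) with h | h | h
    · exact Or.inl (hbetween hpP hp h)
    · rw [h] at hp
      nlinarith [sq_nonneg (viewSlope p (b j))]
    · exact Or.inr (hbetween hpP (by linarith) h)
  have hzig {i j} (h : R i j) :
      ((b i).2 < a₁.2 ∧ a₂.2 < (b j).2) ∨ (a₁.2 < (b i).2 ∧ (b j).2 < a₂.2) := by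
    obtain ⟨p, hpP, hp⟩ := h
    exact hp.zigzag (hqb i j) (hP p hpP) (hP q hqP) ha₁ ha₂ (hb i) (hb j)
  have hpath {i j k} (h : R i j) (h' : R j k) :
      ¬((b j).2 < a₁.2 ∧ a₂.2 < (b j).2) ∧ ¬((b j).2 < a₂.2 ∧ a₁.2 < (b j).2) := by
    obtain ⟨p, hpP, hp⟩ := h
    obtain ⟨p', hpP', hp'⟩ := h'
    have := hP p hpP
    have := hP p' hpP'
    exact ⟨fun ⟨h₁, h₂⟩ => viewSlope_false_of_straddle h₁ h₂ (by linarith) (by linarith)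
        hp.right hp.right' hp'.left hp'.left',
      fun ⟨h₁, h₂⟩ => viewSlope_false_of_straddle h₁ h₂ (by linarith) (by linarith)
        hp.right' hp.right hp'.left' hp'.left⟩
  have hcycle {i j k} (hij : R i j) (hjk : R j k) (hki : R k i) : False := by
    have := hzig hij
    have := hzig hjk
    have := hzig hki
    have := hpath hij hjk
    have := hpath hjk hki
    have := hpath hki hij
    grind
  have htrans {i j k} (hij : R i j) (hjk : R j k) (hik : R i k) : False := by
    have := hzig hij
    have := hzig hjk
    have := hzig hik
    have := hpath hij hjk
    grind
  rcases hR 0 1 (by decide) with h | h <;> rcases hR 1 2 (by decide) with h' | h' <;>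
    rcases hR 0 2 (by decide) with h'' | h''
  exacts [htrans h h' h'', hcycle h h' h'', htrans h'' h' h, htrans h'' h h',
    htrans h h'' h', htrans h' h'' h, hcycle h'' h' h, htrans h' h h'']

/-- Coordinates in a rotated and rescaled frame whose second axis has direction `(n₀, n₁)`. -/
def frameCoord (n₀ n₁ : ℝ) (p : Pt) : ℝ × ℝ := (n₁ * p 0 - n₀ * p 1, n₀ * p 0 + n₁ * p 1)

lemma mem_gabrielDisk_iff {u v w : Pt} :
    w ∈ gabrielDisk u v ↔
      (w 0 - u 0) * (w 0 - v 0) + (w 1 - u 1) * (w 1 - v 1) ≤ 0 := by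
  have h₁ : dist w (midpoint ℝ u v) ^ 2 =
      (w 0 - (u 0 + v 0) / 2) ^ 2 + (w 1 - (u 1 + v 1) / 2) ^ 2 := by
    rw [EuclideanSpace.dist_eq, Real.sq_sqrt (by positivity)]
    simp [Fin.sum_univ_two, Real.dist_eq, sq_abs, midpoint_eq_smul_add]
    ring
  have h₂ : dist u v ^ 2 = (u 0 - v 0) ^ 2 + (u 1 - v 1) ^ 2 := by
    rw [EuclideanSpace.dist_eq, Real.sq_sqrt (by positivity)]
    simp [Fin.sum_univ_two, Real.dist_eq, sq_abs]
  rw [gabrielDisk, Metric.mem_closedBall,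
    ← pow_le_pow_iff_left₀ dist_nonneg (by positivity) two_ne_zero, div_pow, h₁, h₂]
  constructor <;> intro h <;> nlinarith

lemma mem_gabrielDisk_iff_viewSlope {n₀ n₁ : ℝ} (hn : 0 < n₀ ^ 2 + n₁ ^ 2) {u v w : Pt}
    (hu : (frameCoord n₀ n₁ u).2 < (frameCoord n₀ n₁ w).2)
    (hv : (frameCoord n₀ n₁ v).2 < (frameCoord n₀ n₁ w).2) :
    w ∈ gabrielDisk u v ↔
      viewSlope (frameCoord n₀ n₁ w) (frameCoord n₀ n₁ u) *
        viewSlope (frameCoord n₀ n₁ w) (frameCoord n₀ n₁ v) ≤ -1 := by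
  rw [mem_gabrielDisk_iff, viewSlope, viewSlope, div_mul_div_comm,
    div_le_iff₀ (mul_pos (sub_pos.2 hu) (sub_pos.2 hv))]
  have key : (n₀ ^ 2 + n₁ ^ 2) *
      ((w 0 - u 0) * (w 0 - v 0) + (w 1 - u 1) * (w 1 - v 1)) =
      ((frameCoord n₀ n₁ u).1 - (frameCoord n₀ n₁ w).1) *
        ((frameCoord n₀ n₁ v).1 - (frameCoord n₀ n₁ w).1) +
      ((frameCoord n₀ n₁ w).2 - (frameCoord n₀ n₁ u).2) *
        ((frameCoord n₀ n₁ w).2 - (frameCoord n₀ n₁ v).2) := by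
    simp only [frameCoord]
    ring
  constructor <;> intro h
  · nlinarith [mul_nonneg hn.le (neg_nonneg.2 h)]
  · by_contra! hpos
    nlinarith [mul_pos hn hpos]

lemma exists_frameCoord_snd_eq {φ : Pt →ₗ[ℝ] ℝ} (hφ : φ ≠ 0) :
    ∃ n₀ n₁ : ℝ, 0 < n₀ ^ 2 + n₁ ^ 2 ∧ ∀ p, φ p = (frameCoord n₀ n₁ p).2 := by
  have h (p : Pt) : φ p = φ !₂[1, 0] * p 0 + φ !₂[0, 1] * p 1 := by
    have hp : p = p 0 • !₂[(1 : ℝ), 0] + p 1 • !₂[(0 : ℝ), 1] := by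
      ext i
      fin_cases i <;> simp
    conv_lhs => rw [hp]
    simp [mul_comm]
  refine ⟨φ !₂[1, 0], φ !₂[0, 1], ?_, h⟩
  by_contra! hle
  have h₀ : φ !₂[1, 0] = 0 := by nlinarith [sq_nonneg (φ !₂[1, 0]), sq_nonneg (φ !₂[0, 1])]
  have h₁ : φ !₂[0, 1] = 0 := by nlinarith [sq_nonneg (φ !₂[1, 0]), sq_nonneg (φ !₂[0, 1])]
  refine hφ (LinearMap.ext fun p => ?_)
  rw [h, h₀, h₁]
  simp

lemma card_colorClass_le_two {V : Type*} [Fintype V] {G : SimpleGraph V} {c : V → Bool}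
    (hbip : ∀ u v : V, u ≠ v → (G.Adj u v ↔ c u ≠ c v)) {f : V → Pt} {P : Set Pt}
    (hWG : IsWGDrawing G f P) (hsep : LinSep (Set.range f) P) {k k' : Bool} (hk : k ≠ k')
    (hcard : 2 ≤ Fintype.card {v : V // c v = k}) :
    Fintype.card {v : V // c v = k'} ≤ 2 := by
  by_contra! hlt
  obtain ⟨⟨a₁, ha₁⟩, ⟨a₂, ha₂⟩, hne⟩ := Fintype.one_lt_card_iff.1 hcard
  obtain ⟨e⟩ : Nonempty (Fin 3 ↪ {v : V // c v = k'}) :=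
    Function.Embedding.nonempty_of_card_le (by simpa using Nat.succ_le_of_lt hlt)
  obtain ⟨-, -, hadj⟩ := hWG
  obtain ⟨φ, d, hφ, hf, hP⟩ := hsep
  obtain ⟨n₀, n₁, hn, hφn⟩ := exists_frameCoord_snd_eq hφ
  simp only [hφn] at hf hP
  have hf (v : V) : (frameCoord n₀ n₁ (f v)).2 < d := hf _ ⟨v, rfl⟩
  have hmem {w : Pt} (hw : w ∈ P) (u v : V) := mem_gabrielDisk_iff_viewSlope hn
    ((hf u).trans (hP w hw)) ((hf v).trans (hP w hw))
  have hedge {u v : V} (hu : c u = k) (hv : c v = k') : ∀ w ∈ frameCoord n₀ n₁ '' P,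
      -1 < viewSlope w (frameCoord n₀ n₁ (f u)) * viewSlope w (frameCoord n₀ n₁ (f v)) := by
    rintro _ ⟨w, hw, rfl⟩
    have huv : u ≠ v := by
      rintro rfl
      exact hk (hu.symm.trans hv)
    have hempty := (hadj u v huv).1 ((hbip u v huv).2 (by rwa [hu, hv]))
    rw [← not_le, ← hmem hw]
    exact fun h => Set.notMem_empty w (hempty ▸ ⟨h, hw⟩)
  have hnonedge {u v : V} (huv : u ≠ v) (hc : c u = c v) : ∃ w ∈ frameCoord n₀ n₁ '' P,
      viewSlope w (frameCoord n₀ n₁ (f u)) * viewSlope w (frameCoord n₀ n₁ (f v)) ≤ -1 := by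
    have hnonempty := (hadj u v huv).not.1 fun h => (hbip u v huv).1 h hc
    obtain ⟨w, hwD, hw⟩ := Set.nonempty_iff_ne_empty.2 hnonempty
    exact ⟨_, ⟨w, hw, rfl⟩, (hmem hw u v).1 hwD⟩
  refine false_of_two_three (P := frameCoord n₀ n₁ '' P)
    (b := fun i => frameCoord n₀ n₁ (f (e i))) ?_ (hf a₁) (hf a₂) (fun i => hf _)
    (fun i => hedge ha₁ (e i).2) (fun i => hedge ha₂ (e i).2)
    (hnonedge (fun h => hne (Subtype.ext h)) (ha₁.trans ha₂.symm))
    fun i j hij => hnonedge (fun h => hij (e.injective (Subtype.ext h)))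
      ((e i).2.trans (e j).2.symm)
  rintro _ ⟨w, hw, rfl⟩
  exact hP w hw

/-- Lemma 8: a complete bipartite graph admitting a linearly separable WG-drawing has no
`K_{2,3}` subgraph: both color classes have at most two vertices. -/
theorem stmt13 {V : Type*} [Fintype V] (G : SimpleGraph V) (c : V → Bool)
    (hbip : ∀ u v : V, u ≠ v → (G.Adj u v ↔ c u ≠ c v))
    (hm : 2 ≤ Fintype.card {v : V // c v = true})
    (hn : 2 ≤ Fintype.card {v : V // c v = false})
    (f : V → Pt) (P : Set Pt) (hWG : IsWGDrawing G f P)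
    (hsep : LinSep (Set.range f) P) :
    Fintype.card {v : V // c v = true} ≤ 2 ∧ Fintype.card {v : V // c v = false} ≤ 2 :=
  ⟨card_colorClass_le_two hbip hWG hsep (by decide) hn,
    card_colorClass_le_two hbip hWG hsep (by decide) hm⟩
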